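/- arXiv:2111.13422 — 11 statements merged into one kernel-verified Lean document; each statement's English description precedes it below -/
import Mathlib

section
/- Let R be a commutative ring and r, s, r', s' ∈ R. If the free quadratic R-algebras C(r,s) and C(r',s') are isomorphic as R-algebras, then there exists a unit ε of R such that r'² − 4s' = ε²·(r² − 4s). -/
open Polynomial

/-- The free quadratic `R`-algebra `R[x]/(x² + r·x + s)`. -/
noncomputable abbrev QuadAlg (R : Type*) [CommRing R] (r s : R) :=
  AdjoinRoot (X ^ 2 + C r * X + C s)

theorem quad_root_sq {R : Type*} [CommRing R] (r s : R) :
    (AdjoinRoot.root (X ^ 2 + C r * X + C s)) ^ 2 =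
      - (algebraMap R (QuadAlg R r s) r * AdjoinRoot.root _ + algebraMap R (QuadAlg R r s) s) := by
  have h := AdjoinRoot.eval₂_root (X ^ 2 + C r * X + C s)
  simp only [eval₂_add, eval₂_mul, eval₂_pow, eval₂_X, eval₂_C] at h
  rw [AdjoinRoot.algebraMap_eq]
  linear_combination h

theorem quad_indep {R : Type*} [CommRing R] (r s a b : R)
    (h : algebraMap R (QuadAlg R r s) a + algebraMap R (QuadAlg R r s) b * AdjoinRoot.root _ = 0) :
    a = 0 ∧ b = 0 := by
  let f : QuadAlg R r s →+* QuadraticAlgebra R (-s) (-r) :=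
    AdjoinRoot.lift (algebraMap R _) ⟨0, 1⟩ (by
      simp only [eval₂_add, eval₂_mul, eval₂_pow, eval₂_X, eval₂_C, pow_two]
      ext <;> simp)
  have h2 := congrArg f h
  rw [AdjoinRoot.algebraMap_eq] at h2
  simp only [map_add, map_mul, map_zero, f, AdjoinRoot.lift_of, AdjoinRoot.lift_root] at h2
  have h3 := congrArg QuadraticAlgebra.re h2
  have h4 := congrArg QuadraticAlgebra.im h2
  simp at h3 h4
  exact ⟨h3, h4⟩

theorem quad_exists {R : Type*} [CommRing R] (r s : R) (z : QuadAlg R r s) :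
    ∃ a b : R, z = algebraMap R (QuadAlg R r s) a
      + algebraMap R (QuadAlg R r s) b * AdjoinRoot.root _ := by
  induction z using AdjoinRoot.induction_on with
  | ih p =>
    induction p using Polynomial.induction_on with
    | C a => exact ⟨a, 0, by simp [AdjoinRoot.algebraMap_eq]⟩
    | add p q hp hq =>
      obtain ⟨a, b, h⟩ := hp
      obtain ⟨c, d, h'⟩ := hq
      refine ⟨a + c, b + d, ?_⟩
      rw [map_add, h, h', map_add, map_add]; ring
    | monomial n a h =>
      obtain ⟨c, d, h⟩ := h
      refine ⟨-(d * s), c - d * r, ?_⟩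
      rw [pow_succ X n, ← mul_assoc, map_mul, h, AdjoinRoot.mk_X]
      simp only [map_neg, map_sub, map_mul]
      linear_combination (algebraMap R (QuadAlg R r s) d) * quad_root_sq r s

/-- If the free quadratic `R`-algebras `C(r,s)` and `C(r',s')` are
isomorphic as `R`-algebras, then there is a unit `ε` of `R` with
`r'² − 4s' = ε² · (r² − 4s)`. -/
theorem discriminant_isomorphism_invariant
    (R : Type*) [CommRing R] (r s r' s' : R)
    (h : Nonempty (QuadAlg R r s ≃ₐ[R] QuadAlg R r' s')) :
    ∃ ε : Rˣ, r' ^ 2 - 4 * s' = (ε : R) ^ 2 * (r ^ 2 - 4 * s) := by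
  obtain ⟨φ⟩ := h
  obtain ⟨a, b, hab⟩ := quad_exists r' s' (φ (AdjoinRoot.root _))
  obtain ⟨c, d, hcd⟩ := quad_exists r s (φ.symm (AdjoinRoot.root _))
  have h1 := congrArg φ hcd
  simp only [AlgEquiv.apply_symm_apply, map_add, map_mul, AlgEquiv.commutes, hab] at h1
  have h2 := congrArg φ (quad_root_sq r s)
  simp only [map_add, map_mul, map_pow, map_neg, AlgEquiv.commutes, hab] at h2
  have hy := quad_root_sq r' s'
  obtain ⟨-, hdb⟩ := quad_indep r' s' (c + d * a) (d * b - 1) (by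
    simp only [map_add, map_mul, map_sub, map_one]
    linear_combination -h1)
  obtain ⟨e1, e2⟩ := quad_indep r' s' (a ^ 2 + r * a + s - b ^ 2 * s')
    (-b ^ 2 * r' + 2 * a * b + r * b) (by
    simp only [map_add, map_mul, map_sub, map_neg, map_pow, map_ofNat]
    linear_combination h2 - (algebraMap R (QuadAlg R r' s') b) ^ 2 * hy)
  have hdb' : d * b = 1 := by linear_combination hdb
  have e3 : b * r' = 2 * a + r := by
    linear_combination -d * e2 + (-b * r' + 2 * a + r) * hdb
  refine ⟨⟨d, b, hdb', by rw [mul_comm, hdb']⟩, ?_⟩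
  have e4 : b ^ 2 * (r' ^ 2 - 4 * s') = r ^ 2 - 4 * s := by
    linear_combination (b * r' + 2 * a + r) * e3 + 4 * e1
  show _ = d ^ 2 * _
  rw [← e4]
  linear_combination -(d * b + 1) * (r' ^ 2 - 4 * s') * hdb
end

section
/- Let R be a commutative ring in which 2 is a nonzerodivisor, let r, s ∈ R, and let p, β, c ∈ R satisfy p = r + 2β and 4c = p² − (r² − 4s). Then there is an R-algebra isomorphism from C(r,s) to C(p,c) sending the class of x to the class of x plus β (that is, sending the root τ of x²+rx+s to ω + (p−r)/2 where ω is the root of x²+px+c). -/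
open Polynomial

/-- If `2` is a nonzerodivisor in `R`, `p = r + 2β` and
`4c = p² − (r² − 4s)`, then there is an `R`-algebra isomorphism `C(r,s) ≃ C(p,c)`
sending the class of `x` to the class of `x` plus `β`. -/
theorem iso_to_normal_form
    (R : Type*) [CommRing R] (h2 : (2 : R) ∈ nonZeroDivisors R)
    (r s p β c : R) (hp : p = r + 2 * β) (hc : 4 * c = p ^ 2 - (r ^ 2 - 4 * s)) :
    ∃ ψ : QuadAlg R r s ≃ₐ[R] QuadAlg R p c,
      ψ (AdjoinRoot.root _) =
        AdjoinRoot.root _ + algebraMap R (QuadAlg R p c) β := by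
  have hc' : c = β ^ 2 + r * β + s := by
    have h4 : (c - (β ^ 2 + r * β + s)) * 2 * 2 = 0 := by
      subst hp; linear_combination hc
    have h := (mul_right_mem_nonZeroDivisors_eq_zero_iff h2).1
      ((mul_right_mem_nonZeroDivisors_eq_zero_iff h2).1 h4)
    exact sub_eq_zero.1 h
  have key : ∀ a b : R, AdjoinRoot.root (X ^ 2 + C a * X + C b) ^ 2
      + algebraMap R (QuadAlg R a b) a * AdjoinRoot.root (X ^ 2 + C a * X + C b)
      + algebraMap R (QuadAlg R a b) b = 0 := by
    intro a b
    have h := AdjoinRoot.eval₂_root (X ^ 2 + C a * X + C b)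
    simpa [eval₂_add, eval₂_mul, AdjoinRoot.algebraMap_eq] using h
  have h1 : aeval (AdjoinRoot.root (X ^ 2 + C p * X + C c) + algebraMap R (QuadAlg R p c) β)
      (X ^ 2 + C r * X + C s) = 0 := by
    have h := key p c
    have e1 := congrArg (algebraMap R (QuadAlg R p c)) hp
    have e2 := congrArg (algebraMap R (QuadAlg R p c)) hc'
    simp only [map_add, map_mul, map_pow, map_ofNat, aeval_X, aeval_C] at e1 e2 ⊢
    linear_combination h - AdjoinRoot.root (X ^ 2 + C p * X + C c) * e1 - e2
  have h3 : aeval (AdjoinRoot.root (X ^ 2 + C r * X + C s) - algebraMap R (QuadAlg R r s) β)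
      (X ^ 2 + C p * X + C c) = 0 := by
    have h := key r s
    have e1 := congrArg (algebraMap R (QuadAlg R r s)) hp
    have e2 := congrArg (algebraMap R (QuadAlg R r s)) hc'
    simp only [map_add, map_mul, map_pow, map_ofNat, aeval_X, aeval_C] at e1 e2 ⊢
    linear_combination h + (AdjoinRoot.root (X ^ 2 + C r * X + C s)
      - algebraMap R (QuadAlg R r s) β) * e1 + e2
  refine ⟨AlgEquiv.ofAlgHom (AdjoinRoot.liftAlgHom _ (Algebra.ofId R _) _ h1)
    (AdjoinRoot.liftAlgHom _ (Algebra.ofId R _) _ h3) ?_ ?_, ?_⟩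
  · apply AdjoinRoot.algHom_ext
    simp [Algebra.ofId_apply]
  · apply AdjoinRoot.algHom_ext
    simp [Algebra.ofId_apply]
  · simp
end

section
/- Let R be a commutative ring in which 2 is a nonzerodivisor, and let r, s, r', s' ∈ R. Then the free quadratic R-algebras C(r,s) and C(r',s') are isomorphic as R-algebras if and only if there exists a unit ε of R such that r' − ε·r ∈ 2R and r'² − 4s' = ε²·(r² − 4s). -/
open Polynomial

theorem qa_monic {R : Type*} [CommRing R] (r s : R) : (X ^ 2 + C r * X + C s : R[X]).Monic := by
  monicity!

theorem qa_rel {R : Type*} [CommRing R] (r s : R) :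
    (AdjoinRoot.root (X ^ 2 + C r * X + C s) : QuadAlg R r s) ^ 2
      + algebraMap R (QuadAlg R r s) r * AdjoinRoot.root (X ^ 2 + C r * X + C s)
      + algebraMap R (QuadAlg R r s) s = 0 := by
  have h := AdjoinRoot.eval₂_root (X ^ 2 + C r * X + C s)
  simpa [eval₂_add, eval₂_mul, eval₂_pow] using h

theorem qa_indep {R : Type*} [CommRing R] (r s a b : R)
    (h : algebraMap R (QuadAlg R r s) a
      + algebraMap R (QuadAlg R r s) b * AdjoinRoot.root (X ^ 2 + C r * X + C s) = 0) :
    a = 0 ∧ b = 0 := by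
  nontriviality R
  have h1 : AdjoinRoot.mk (X ^ 2 + C r * X + C s) (C b * X + C a) = 0 := by
    rw [← h]
    simp [add_comm]
  have h0 : (C b * X + C a : R[X]) = 0 := by
    by_contra hne
    refine AdjoinRoot.mk_ne_zero_of_degree_lt (qa_monic r s) hne ?_ h1
    have : (X ^ 2 + C r * X + C s : R[X]).degree = 2 := by compute_degree!
    rw [this]
    exact lt_of_le_of_lt degree_linear_le (by norm_num)
  constructor
  · simpa using congrArg (fun p => coeff p 0) h0
  · simpa using congrArg (fun p => coeff p 1) h0

theorem qa_rep {R : Type*} [CommRing R] (r s : R) (z : QuadAlg R r s) :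
    ∃ a b : R, z = algebraMap R (QuadAlg R r s) a
      + algebraMap R (QuadAlg R r s) b * AdjoinRoot.root (X ^ 2 + C r * X + C s) := by
  induction z using AdjoinRoot.induction_on with
  | ih p =>
    induction p using Polynomial.induction_on' with
    | add p q hp hq =>
      obtain ⟨a, b, h⟩ := hp
      obtain ⟨c, d, h'⟩ := hq
      refine ⟨a + c, b + d, ?_⟩
      rw [map_add, h, h', map_add, map_add]
      ring
    | monomial n t =>
      induction n with
      | zero => exact ⟨t, 0, by simp⟩
      | succ n ih =>
        obtain ⟨a, b, h⟩ := ih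
        refine ⟨- (b * s), a - b * r, ?_⟩
        rw [← monomial_mul_X, map_mul, h, AdjoinRoot.mk_X]
        have hr := qa_rel r s
        simp only [map_neg, map_mul, map_sub]
        linear_combination (algebraMap R (QuadAlg R r s) b) * hr

/-- When `2` is a nonzerodivisor in `R`, the free quadratic algebras
`C(r,s)` and `C(r',s')` are isomorphic as `R`-algebras if and only if there is a unit
`ε` of `R` with `r' − ε·r ∈ 2R` and `r'² − 4s' = ε² · (r² − 4s)`. -/
theorem classification_free_quadratic_algebras
    (R : Type*) [CommRing R] (h2 : (2 : R) ∈ nonZeroDivisors R)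
    (r s r' s' : R) :
    Nonempty (QuadAlg R r s ≃ₐ[R] QuadAlg R r' s') ↔
      ∃ ε : Rˣ, r' - (ε : R) * r ∈ Ideal.span ({2} : Set R) ∧
        r' ^ 2 - 4 * s' = (ε : R) ^ 2 * (r ^ 2 - 4 * s) := by
  constructor
  · rintro ⟨φ⟩
    obtain ⟨a, u, hu⟩ := qa_rep r' s' (φ (AdjoinRoot.root _))
    obtain ⟨b, v, hv⟩ := qa_rep r s (φ.symm (AdjoinRoot.root _))
    have e1 := congrArg φ.symm hu
    rw [AlgEquiv.symm_apply_apply, map_add, map_mul, AlgEquiv.commutes, AlgEquiv.commutes, hv] at e1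
    have e2 := qa_indep r s (a + u * b) (u * v - 1) (by
      simp only [map_add, map_mul, map_sub, map_one]
      linear_combination -e1)
    have huv : u * v = 1 := by linear_combination e2.2
    have e3 := congrArg φ (qa_rel r s)
    simp only [map_add, map_mul, map_pow, AlgEquiv.commutes, hu, map_zero] at e3
    have e4 := qa_indep r' s' (a ^ 2 - u ^ 2 * s' + r * a + s) (2 * a * u - u ^ 2 * r' + r * u) (by
      simp only [map_add, map_mul, map_sub, map_pow, map_ofNat]
      linear_combination e3 - (algebraMap R (QuadAlg R r' s') u) ^ 2 * qa_rel r' s')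
    obtain ⟨c0, c1⟩ := e4
    have hr : r' = v * (r + 2 * a) := by
      linear_combination (-v ^ 2) * c1 + (v * (r + 2 * a) - r' * (u * v + 1)) * huv
    have hs : s' = v ^ 2 * (a ^ 2 + r * a + s) := by
      linear_combination (-v ^ 2) * c0 - s' * (u * v + 1) * huv
    refine ⟨⟨v, u, by rw [mul_comm]; exact huv, huv⟩, ?_, ?_⟩
    · rw [Ideal.mem_span_singleton]
      exact ⟨v * a, by simp only [hr]; ring⟩
    · simp only [hr, hs]
      ring
  · rintro ⟨ε, h, hd⟩
    rw [Ideal.mem_span_singleton] at h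
    obtain ⟨c, hc⟩ := h
    obtain ⟨v, u, hvu, huv⟩ := ε
    simp only at hc hd
    have hr : r' = v * r + 2 * c := by linear_combination hc
    subst hr
    have h4 : (v * r * c + c ^ 2 - s' + v ^ 2 * s) * 2 * 2 = 0 := by linear_combination hd
    have hs0 := (mem_nonZeroDivisors_iff_right.mp h2) _ ((mem_nonZeroDivisors_iff_right.mp h2) _ h4)
    have hs : s' = v * r * c + c ^ 2 + v ^ 2 * s := by linear_combination -hs0
    subst hs
    set r' := v * r + 2 * c with hr'
    set s' := v * r * c + c ^ 2 + v ^ 2 * s with hs'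
    let y : QuadAlg R r' s' := AdjoinRoot.root (X ^ 2 + C r' * X + C s')
    let x : QuadAlg R r s := AdjoinRoot.root (X ^ 2 + C r * X + C s)
    have hy : y ^ 2 + algebraMap R _ r' * y + algebraMap R _ s' = 0 := qa_rel r' s'
    have hx : x ^ 2 + algebraMap R _ r * x + algebraMap R _ s = 0 := qa_rel r s
    have mvu : algebraMap R (QuadAlg R r s) v * algebraMap R (QuadAlg R r s) u = 1 := by
      rw [← map_mul, hvu, map_one]
    have mvu' : algebraMap R (QuadAlg R r' s') v * algebraMap R (QuadAlg R r' s') u = 1 := by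
      rw [← map_mul, hvu, map_one]
    let f : QuadAlg R r s →ₐ[R] QuadAlg R r' s' :=
      AdjoinRoot.liftAlgHom _ (Algebra.ofId R _)
        (algebraMap R _ u * (y + algebraMap R _ c)) (by
          simp only [eval₂_add, eval₂_mul, eval₂_pow, eval₂_X, eval₂_C, RingHom.coe_coe,
            Algebra.ofId_apply]
          simp only [hr', hs', map_add, map_mul, map_pow, map_ofNat] at hy
          generalize algebraMap R (QuadAlg R r' s') u = U at *
          generalize algebraMap R (QuadAlg R r' s') v = V at *
          generalize algebraMap R (QuadAlg R r' s') c = K at *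
          generalize algebraMap R (QuadAlg R r' s') r = A at *
          generalize algebraMap R (QuadAlg R r' s') s = B at *
          linear_combination U ^ 2 * hy - (U * A * (y + K) + B * (V * U + 1)) * mvu')
    let g : QuadAlg R r' s' →ₐ[R] QuadAlg R r s :=
      AdjoinRoot.liftAlgHom _ (Algebra.ofId R _)
        (algebraMap R _ v * x - algebraMap R _ c) (by
          simp only [eval₂_add, eval₂_mul, eval₂_pow, eval₂_X, eval₂_C, RingHom.coe_coe,
            Algebra.ofId_apply]
          simp only [hr', hs', map_add, map_mul, map_pow, map_ofNat]
          linear_combination (algebraMap R (QuadAlg R r s) v) ^ 2 * hx)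
    have hf : f x = algebraMap R _ u * (y + algebraMap R _ c) := AdjoinRoot.liftAlgHom_root _ _ _ _
    have hg : g y = algebraMap R _ v * x - algebraMap R _ c := AdjoinRoot.liftAlgHom_root _ _ _ _
    refine ⟨AlgEquiv.ofAlgHom f g (AdjoinRoot.algHom_ext ?_) (AdjoinRoot.algHom_ext ?_)⟩
    · change f (g y) = y
      rw [hg, map_sub, map_mul, AlgHom.commutes, AlgHom.commutes, hf]
      linear_combination (y + algebraMap R _ c) * mvu'
    · change g (f x) = x
      rw [hf, map_mul g, map_add g, AlgHom.commutes, AlgHom.commutes, hg]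
      linear_combination x * mvu
end

section
/- Let R be an integrally closed integral domain. If p, p' ∈ R satisfy p² − p'² ∈ 4R (the ideal generated by 4), then p − p' ∈ 2R (the ideal generated by 2). -/
/-- If `R` is an integrally closed integral domain and
`p² − p'² ∈ 4R`, then `p − p' ∈ 2R`. -/
theorem parity_determined_integrally_closed
    (R : Type*) [CommRing R] [IsDomain R] [IsIntegrallyClosed R]
    (p p' : R) (h : p ^ 2 - p' ^ 2 ∈ Ideal.span ({4} : Set R)) :
    p - p' ∈ Ideal.span ({2} : Set R) := by
  rw [Ideal.mem_span_singleton] at h ⊢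
  obtain ⟨c, hc⟩ := h
  by_cases h2 : (2 : R) = 0
  · have h0 : (p - p') ^ 2 = 0 := by
      linear_combination hc + (2 * c + p' ^ 2 - p * p') * h2
    rw [pow_eq_zero_iff two_ne_zero] at h0
    rw [h0]
    exact dvd_zero _
  · obtain ⟨f, hf⟩ : ∃ f : R →+* FractionRing R, f = algebraMap R (FractionRing R) := ⟨_, rfl⟩
    have hinj : Function.Injective f := hf ▸ IsFractionRing.injective R (FractionRing R)
    have h2K : (2 : FractionRing R) ≠ 0 := by
      intro h
      apply h2
      apply hinj
      rw [map_ofNat, map_zero]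
      exact h
    have hcK : f p ^ 2 - f p' ^ 2 = 4 * f c := by
      have := congrArg f hc
      rwa [map_sub, map_pow, map_pow, map_mul, map_ofNat] at this
    have hx : IsIntegral R ((f p - f p') / 2) := by
      refine ⟨Polynomial.X ^ 2 + (Polynomial.C p' * Polynomial.X - Polynomial.C c), ?_, ?_⟩
      · apply Polynomial.monic_X_pow_add
        compute_degree!
      · simp only [Polynomial.eval₂_add, Polynomial.eval₂_sub, Polynomial.eval₂_mul,
          Polynomial.eval₂_pow, Polynomial.eval₂_X, Polynomial.eval₂_C]
        rw [← hf]
        change ((f p - f p') / 2) ^ 2 + (f p' * ((f p - f p') / 2) - f c) = 0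
        field_simp
        linear_combination hcK
    obtain ⟨y, hy⟩ := IsIntegrallyClosed.isIntegral_iff.mp hx
    refine ⟨y, hinj ?_⟩
    have hy' : f y = (f p - f p') / 2 := by rw [← hy, hf]
    rw [map_sub, map_mul, hy', map_ofNat]
    field_simp
end

section
/- Let R be a commutative ring in which 2 is a nonzerodivisor, and let r, s, r', s' ∈ R satisfy r' − r ∈ 2R and r'² − 4s' = r² − 4s. Then there exists a unique R-algebra isomorphism ψ from C(r,s) to C(r',s') such that ψ(τ) − τ' lies in the image of R (where τ and τ' denote the respective generators, i.e. the classes of x); moreover ψ(τ) = τ' + γ·1 where γ ∈ R is the unique element with 2γ = r' − r. -/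
open Polynomial

theorem quad_mk_lin {R : Type*} [CommRing R] (r s a b : R)
    (h : algebraMap R (QuadAlg R r s) a * AdjoinRoot.root _ + algebraMap R (QuadAlg R r s) b = 0) :
    a = 0 := by
  nontriviality R
  have h1 : AdjoinRoot.mk (X ^ 2 + C r * X + C s) (C a * X + C b) = 0 := by
    rw [map_add, map_mul, AdjoinRoot.mk_X, AdjoinRoot.mk_C, AdjoinRoot.mk_C]
    exact h
  rw [AdjoinRoot.mk_eq_zero] at h1
  have hm : (X ^ 2 + C r * X + C s : R[X]).Monic := by monicity!
  have hd : (X ^ 2 + C r * X + C s : R[X]).degree = 2 := by compute_degree!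
  have h0 : (C a * X + C b : R[X]) = 0 := by
    by_contra hne
    refine hm.not_dvd_of_degree_lt hne ?_ h1
    rw [hd]
    exact lt_of_le_of_lt degree_linear_le (by norm_num)
  simpa using congrArg (fun p => coeff p 1) h0

theorem quad_root_eq {R : Type*} [CommRing R] (r s : R) :
    (AdjoinRoot.root _ : QuadAlg R r s) ^ 2 + algebraMap R (QuadAlg R r s) r * AdjoinRoot.root _
      + algebraMap R (QuadAlg R r s) s = 0 := by
  have h := AdjoinRoot.mk_self (f := (X ^ 2 + C r * X + C s : R[X]))
  rw [map_add, map_add, map_mul, map_pow, AdjoinRoot.mk_X, AdjoinRoot.mk_C, AdjoinRoot.mk_C] at h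
  exact h

theorem quad_hom {R : Type*} [CommRing R] (r s r' s' g : R) (h1 : r' = r + 2 * g)
    (h2 : s' = g ^ 2 + r * g + s) :
    ∃ f : QuadAlg R r s →ₐ[R] QuadAlg R r' s', f (AdjoinRoot.root _) =
      AdjoinRoot.root _ + algebraMap R (QuadAlg R r' s') g := by
  refine ⟨AdjoinRoot.liftAlgHom _ (Algebra.ofId R _)
    (AdjoinRoot.root _ + algebraMap R (QuadAlg R r' s') g) ?_, ?_⟩
  · have h := quad_root_eq r' s'
    subst h1 h2
    simp only [eval₂_add, eval₂_mul, eval₂_pow, eval₂_X, eval₂_C, RingHom.coe_coe,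
      Algebra.ofId_apply]
    simp only [map_add, map_mul, map_pow, map_ofNat] at h
    linear_combination h
  · simp

/-- When `2` is a nonzerodivisor in `R`, `r' − r = 2γ` and
`r'² − 4s' = r² − 4s`, there is a unique `R`-algebra isomorphism
`ψ : C(r,s) ≃ C(r',s')` with `ψ(τ) − τ'` in the image of `R`; moreover any such `ψ`
satisfies `ψ(τ) = τ' + γ·1`. -/
theorem unique_oriented_isomorphism
    (R : Type*) [CommRing R] (h2 : (2 : R) ∈ nonZeroDivisors R)
    (r s r' s' γ : R) (hγ : r' - r = 2 * γ)
    (hdisc : r' ^ 2 - 4 * s' = r ^ 2 - 4 * s) :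
    (∃! ψ : QuadAlg R r s ≃ₐ[R] QuadAlg R r' s',
        ∃ α : R, ψ (AdjoinRoot.root _) =
          AdjoinRoot.root _ + algebraMap R (QuadAlg R r' s') α) ∧
      ∀ ψ : QuadAlg R r s ≃ₐ[R] QuadAlg R r' s',
        (∃ α : R, ψ (AdjoinRoot.root _) =
          AdjoinRoot.root _ + algebraMap R (QuadAlg R r' s') α) →
        ψ (AdjoinRoot.root _) =
          AdjoinRoot.root _ + algebraMap R (QuadAlg R r' s') γ := by
  have key : ∀ ψ : QuadAlg R r s ≃ₐ[R] QuadAlg R r' s',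
        (∃ α : R, ψ (AdjoinRoot.root _) =
          AdjoinRoot.root _ + algebraMap R (QuadAlg R r' s') α) →
        ψ (AdjoinRoot.root _) =
          AdjoinRoot.root _ + algebraMap R (QuadAlg R r' s') γ := by
    rintro ψ ⟨α, hα⟩
    have h := congrArg ψ (quad_root_eq r s)
    rw [map_add, map_add, map_mul, map_pow, AlgEquiv.commutes, AlgEquiv.commutes, hα,
      map_zero] at h
    have h' := quad_root_eq r' s'
    have h3 := quad_mk_lin r' s' (2 * α + r - r') (α ^ 2 + r * α + s - s') (by
      simp only [map_add, map_sub, map_mul, map_pow, map_ofNat]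
      linear_combination h - h')
    have h4 : α = γ := by
      rw [← sub_eq_zero]
      refine (mem_nonZeroDivisors_iff.1 h2).1 _ ?_
      linear_combination h3 + hγ
    rw [hα, h4]
  refine ⟨?_, key⟩
  have hr : r' = r + 2 * γ := by linear_combination hγ
  have hs : s' = γ ^ 2 + r * γ + s := by
    rw [← sub_eq_zero]
    refine (mem_nonZeroDivisors_iff.1 h2).1 _ ((mem_nonZeroDivisors_iff.1 h2).1 _ ?_)
    subst hr
    linear_combination -hdisc
  obtain ⟨f, hf⟩ := quad_hom r s r' s' γ hr hs
  obtain ⟨g, hg⟩ := quad_hom r' s' r s (-γ) (by rw [hr]; ring) (by rw [hs, hr]; ring)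
  have e1 : f.comp g = AlgHom.id R _ := by
    apply AdjoinRoot.algHom_ext
    simp [hf, hg, -AdjoinRoot.algebraMap_eq]
  have e2 : g.comp f = AlgHom.id R _ := by
    apply AdjoinRoot.algHom_ext
    simp [hf, hg, -AdjoinRoot.algebraMap_eq]
  refine ⟨AlgEquiv.ofAlgHom f g e1 e2, ⟨γ, hf⟩, ?_⟩
  · intro ψ hψ
    have hk := key ψ hψ
    apply AlgEquiv.coe_algHom_injective
    apply AdjoinRoot.algHom_ext
    simpa using hk.trans hf.symm
end

section
/- Let R be a commutative ring, let r, s, r', s' ∈ R, and let ψ be an R-algebra isomorphism from C(r,s) to C(r',s') such that ψ(τ) − τ' lies in the image of R (where τ and τ' denote the respective generators). Then r' − r ∈ 2R and r'² − 4s' = r² − 4s. -/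
open Polynomial

/-- If `ψ : C(r,s) ≃ C(r',s')` is an `R`-algebra isomorphism with
`ψ(τ) − τ'` in the image of `R` (an oriented isomorphism), then `r' − r ∈ 2R` and
`r'² − 4s' = r² − 4s`. -/
theorem oriented_type_invariant
    (R : Type*) [CommRing R] (r s r' s' : R)
    (ψ : QuadAlg R r s ≃ₐ[R] QuadAlg R r' s')
    (hψ : ∃ α : R, ψ (AdjoinRoot.root _) =
      AdjoinRoot.root _ + algebraMap R (QuadAlg R r' s') α) :
    r' - r ∈ Ideal.span ({2} : Set R) ∧ r' ^ 2 - 4 * s' = r ^ 2 - 4 * s := by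
  obtain ⟨α, hα⟩ := hψ
  have h0 : (AdjoinRoot.root (X ^ 2 + C r * X + C s)) ^ 2
      + algebraMap R (QuadAlg R r s) r * AdjoinRoot.root (X ^ 2 + C r * X + C s)
      + algebraMap R (QuadAlg R r s) s = 0 := by
    have := AdjoinRoot.eval₂_root (X ^ 2 + C r * X + C s)
    simpa [AdjoinRoot.algebraMap_eq] using this
  have h0' : (AdjoinRoot.root (X ^ 2 + C r' * X + C s')) ^ 2
      + algebraMap R (QuadAlg R r' s') r' * AdjoinRoot.root (X ^ 2 + C r' * X + C s')
      + algebraMap R (QuadAlg R r' s') s' = 0 := by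
    have := AdjoinRoot.eval₂_root (X ^ 2 + C r' * X + C s')
    simpa [AdjoinRoot.algebraMap_eq] using this
  have h1 := congrArg ψ h0
  rw [map_add, map_add, map_mul, map_pow, map_zero, hα, AlgEquiv.commutes,
    AlgEquiv.commutes] at h1
  have h2 : AdjoinRoot.mk (X ^ 2 + C r' * X + C s')
      (C (2 * α + r - r') * X + C (α ^ 2 + r * α + s - s')) = 0 := by
    rw [map_add, map_mul, AdjoinRoot.mk_X, AdjoinRoot.mk_C, AdjoinRoot.mk_C,
      ← AdjoinRoot.algebraMap_eq]
    simp only [map_add, map_sub, map_mul, map_pow, map_ofNat]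
    linear_combination h1 - h0'
  rw [AdjoinRoot.mk_eq_zero] at h2
  have h3 : C (2 * α + r - r') * X + C (α ^ 2 + r * α + s - s') = 0 := by
    nontriviality R
    have hd : (X ^ 2 + C r' * X + C s').degree = 2 := by
      compute_degree!
    have hm : (X ^ 2 + C r' * X + C s').Monic := by
      monicity!
    by_contra hne
    refine hm.not_dvd_of_degree_lt hne ?_ h2
    rw [hd]
    exact lt_of_le_of_lt degree_linear_le (by norm_num)
  have ha : 2 * α + r - r' = 0 := by
    generalize 2 * α + r - r' = a at h3 ⊢
    generalize α ^ 2 + r * α + s - s' = b at h3 ⊢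
    simpa using congrArg (coeff · 1) h3
  have hb : α ^ 2 + r * α + s - s' = 0 := by
    generalize 2 * α + r - r' = a at h3 ⊢
    generalize α ^ 2 + r * α + s - s' = b at h3 ⊢
    simpa using congrArg (coeff · 0) h3
  refine ⟨Ideal.mem_span_singleton.2 ⟨α, by linear_combination -ha⟩, ?_⟩
  linear_combination 4 * hb - (2 * α + r + r') * ha
end

section
/- Let R = ℤ[√8] be the ring of elements a + b√8 with a, b ∈ ℤ. Then the free quadratic R-algebras R[x]/(x² − 3) and R[y]/(y² + √8·y − 1) both have discriminant 12, but they are not isomorphic as R-algebras. -/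
open Polynomial

/-- Over `R = ℤ[√8]`, the free quadratic algebras `R[x]/(x² − 3)`
(i.e. `C(0, −3)`) and `R[y]/(y² + √8·y − 1)` (i.e. `C(√8, −1)`) both have
discriminant `12`, but are not isomorphic as `R`-algebras. -/
theorem zsqrt8_nonisomorphic_same_discriminant :
    ((0 : ℤ√8) ^ 2 - 4 * (-3) = 12) ∧
    ((Zsqrtd.sqrtd : ℤ√8) ^ 2 - 4 * (-1) = 12) ∧
    IsEmpty (QuadAlg (ℤ√8) 0 (-3) ≃ₐ[ℤ√8] QuadAlg (ℤ√8) Zsqrtd.sqrtd (-1)) := by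
  refine ⟨by ext <;> norm_num, by ext <;> simp [pow_two], ⟨fun e => ?_⟩⟩
  have h2 : (2 : DualNumber (ZMod 2)) = 0 := by
    ext
    · change ((2 : ZMod 2)) = 0
      decide
    · rfl
  have h8 : (DualNumber.eps : DualNumber (ZMod 2)) * DualNumber.eps = ((8 : ℤ) : DualNumber (ZMod 2)) := by
    rw [DualNumber.eps_mul_eps]
    push_cast
    linear_combination (-4) * h2
  let φ : ℤ√8 →+* DualNumber (ZMod 2) := Zsqrtd.lift ⟨DualNumber.eps, h8⟩
  have hφ : φ Zsqrtd.sqrtd = DualNumber.eps := by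
    simp [φ, Zsqrtd.lift]
  let f : QuadAlg (ℤ√8) 0 (-3) →+* DualNumber (ZMod 2) := AdjoinRoot.lift φ 1 (by
    simp
    rw [map_ofNat]
    linear_combination (-1) * h2)
  have hf : ∀ r : ℤ√8, f (algebraMap _ _ r) = φ r := fun r => AdjoinRoot.lift_of _
  have hy : (AdjoinRoot.root _ : QuadAlg (ℤ√8) Zsqrtd.sqrtd (-1)) ^ 2
      + algebraMap (ℤ√8) _ Zsqrtd.sqrtd * AdjoinRoot.root _ + algebraMap (ℤ√8) _ (-1) = 0 := by
    have := AdjoinRoot.eval₂_root (X ^ 2 + C (Zsqrtd.sqrtd : ℤ√8) * X + C (-1))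
    simpa only [eval₂_add, eval₂_mul, eval₂_pow, eval₂_X, eval₂_C, AdjoinRoot.algebraMap_eq] using this
  have hw := congrArg (fun z => f (e.symm z)) hy
  simp only [map_add, map_mul, map_pow, AlgEquiv.commutes, hf, hφ, map_zero] at hw
  generalize f (e.symm _) = w at hw
  have key : ∀ a b : ZMod 2, a * a - 1 = 0 → a * b + b * a + a = 0 → False := by decide
  refine key w.fst w.snd ?_ ?_
  · have := congrArg TrivSqZeroExt.fst hw
    simpa [pow_two, sub_eq_add_neg] using this
  · have := congrArg TrivSqZeroExt.snd hw
    simpa [pow_two] using this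
end

section
/- Let F₄ be the finite field with 4 elements and let a ∈ F₄ with a ≠ 0 and a ≠ 1. Then the F₄-algebras F₄[x]/(x² + x + 1) and F₄[y]/(y² + y + a) are not isomorphic as F₄-algebras. -/
open Polynomial

/-- Let `F₄ = GaloisField 2 2` and `a ∈ F₄` with `a ≠ 0`, `a ≠ 1`.
Then `F₄[x]/(x² + x + 1)` and `F₄[y]/(y² + y + a)` are not isomorphic as
`F₄`-algebras. -/
theorem char_two_same_type_not_isomorphic
    (a : GaloisField 2 2) (ha0 : a ≠ 0) (ha1 : a ≠ 1) :
    IsEmpty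
      (AdjoinRoot (X ^ 2 + X + 1 : Polynomial (GaloisField 2 2)) ≃ₐ[GaloisField 2 2]
        AdjoinRoot (X ^ 2 + X + C a)) := by
  constructor
  intro e
  have : Finite (GaloisField 2 2) := inferInstance
  have hp : ∀ t : GaloisField 2 2, t ^ 4 = t := by
    intro t
    have := Fintype.ofFinite (GaloisField 2 2)
    have hc : Fintype.card (GaloisField 2 2) = 4 := by
      rw [← Nat.card_eq_fintype_card, GaloisField.card 2 2 (by norm_num)]
      norm_num
    have h := FiniteField.pow_card t
    rwa [hc] at h
  have h2 : (2 : GaloisField 2 2) = 0 := by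
    exact_mod_cast CharP.cast_eq_zero (GaloisField 2 2) 2
  have haa : a ^ 2 + a + 1 = 0 := by
    have h : a * ((a - 1) * (a ^ 2 + a + 1)) = 0 := by linear_combination hp a
    exact ((mul_eq_zero.mp ((mul_eq_zero.mp h).resolve_left ha0)).resolve_left
      (sub_ne_zero.mpr ha1))
  let f : AdjoinRoot (X ^ 2 + X + 1 : Polynomial (GaloisField 2 2)) →ₐ[GaloisField 2 2]
      GaloisField 2 2 :=
    AdjoinRoot.liftAlgHom _ (Algebra.ofId _ _) a (by simpa using haa)
  let g := f.comp e.symm.toAlgHom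
  have hr : (AdjoinRoot.root (X ^ 2 + X + C a)) ^ 2 + AdjoinRoot.root (X ^ 2 + X + C a)
      + algebraMap (GaloisField 2 2) _ a = 0 := by
    have h := AdjoinRoot.eval₂_root (X ^ 2 + X + C a)
    simpa [AdjoinRoot.algebraMap_eq] using h
  have hg := congrArg g hr
  rw [map_add, map_add, map_pow, map_zero, AlgHom.commutes] at hg
  generalize g (AdjoinRoot.root (X ^ 2 + X + C a)) = t at hg
  change t ^ 2 + t + a = 0 at hg
  have ht := hp t
  have : (1 : GaloisField 2 2) = 0 := by
    linear_combination ht - (t ^ 2 - t - a + 1) * hg + haa - (t * a + 1) * h2 + h2 + (t - a ^ 2) * h2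
  exact one_ne_zero this
end

section
/- Let R = ℤ/4ℤ and let s, s' ∈ R. If the R-algebras R[x]/(x² − s) and R[y]/(y² − s') are isomorphic as R-algebras, then s = s'. -/
open Polynomial

lemma aux_exists (s : ZMod 4) (z : AdjoinRoot (X ^ 2 - C s)) :
    ∃ a b : ZMod 4, z = algebraMap _ _ a + algebraMap _ _ b * AdjoinRoot.root (X ^ 2 - C s) := by
  have hm : (X ^ 2 - C s).Monic := monic_X_pow_sub_C s two_ne_zero
  haveI : Nontrivial (ZMod 4) := ⟨0, 1, by decide⟩
  obtain ⟨p, rfl⟩ := AdjoinRoot.mk_surjective z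
  have hd : (p %ₘ (X ^ 2 - C s)).natDegree < 2 := by
    have := natDegree_modByMonic_lt p hm (by
      intro h
      have := congrArg natDegree h
      rw [natDegree_X_pow_sub_C] at this
      simp at this)
    rwa [natDegree_X_pow_sub_C] at this
  obtain ⟨b, a, hab⟩ := exists_eq_X_add_C_of_natDegree_le_one (Nat.lt_succ_iff.mp hd)
  refine ⟨a, b, ?_⟩
  have h1 : AdjoinRoot.mk (X ^ 2 - C s) p = AdjoinRoot.mk (X ^ 2 - C s) (p %ₘ (X ^ 2 - C s)) := by
    conv_lhs => rw [← modByMonic_add_div p (X ^ 2 - C s)]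
    simp only [map_add, map_mul, AdjoinRoot.mk_self, zero_mul, add_zero]
  rw [h1, hab, map_add, map_mul, AdjoinRoot.mk_X, AdjoinRoot.mk_C, AdjoinRoot.mk_C, add_comm]
  rfl

lemma aux_zero (s a b : ZMod 4)
    (h : algebraMap _ _ a + algebraMap _ _ b * AdjoinRoot.root (X ^ 2 - C s) = 0) :
    a = 0 ∧ b = 0 := by
  have hm : (X ^ 2 - C s).Monic := monic_X_pow_sub_C s two_ne_zero
  haveI : Nontrivial (ZMod 4) := ⟨0, 1, by decide⟩
  have h1 : AdjoinRoot.mk (X ^ 2 - C s) (C b * X + C a) = 0 := by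
    rw [map_add, map_mul, AdjoinRoot.mk_X, AdjoinRoot.mk_C, AdjoinRoot.mk_C, add_comm]
    exact h
  rw [AdjoinRoot.mk_eq_zero] at h1
  have h2 : C b * X + C a = 0 := by
    by_contra hne
    refine hm.not_dvd_of_natDegree_lt hne ?_ h1
    rw [natDegree_X_pow_sub_C]
    exact lt_of_le_of_lt natDegree_linear_le (by norm_num)
  constructor
  · simpa using congrArg (fun p => coeff p 0) h2
  · simpa using congrArg (fun p => coeff p 1) h2

lemma aux_root (s : ZMod 4) :
    AdjoinRoot.root (X ^ 2 - C s) ^ 2 = algebraMap _ _ s := by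
  have h := AdjoinRoot.mk_self (f := X ^ 2 - C s)
  rw [map_sub, map_pow, AdjoinRoot.mk_X, AdjoinRoot.mk_C, sub_eq_zero] at h
  exact h

/-- Over `R = ℤ/4ℤ`, if `R[x]/(x² − s)` and `R[y]/(y² − s')` are
isomorphic as `R`-algebras, then `s = s'`. -/
theorem zmod4_quadratic_algebras_pairwise_nonisomorphic
    (s s' : ZMod 4)
    (h : Nonempty
      (AdjoinRoot (X ^ 2 - C s) ≃ₐ[ZMod 4] AdjoinRoot (X ^ 2 - C s'))) :
    s = s' := by
  obtain ⟨e⟩ := h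
  obtain ⟨a, b, hab⟩ := aux_exists s' (e (AdjoinRoot.root _))
  obtain ⟨c, d, hcd⟩ := aux_exists s (e.symm (AdjoinRoot.root _))
  have h1 := congrArg e hcd
  rw [e.apply_symm_apply, map_add, map_mul, e.commutes, e.commutes, hab] at h1
  have h2 := congrArg e (aux_root s)
  rw [map_pow, e.commutes, hab] at h2
  have h3 := aux_root s'
  obtain ⟨-, k1⟩ := aux_zero s' (c + d * a) (d * b - 1) (by
    simp only [map_add, map_mul, map_sub, map_one]
    linear_combination -h1)
  obtain ⟨k2, k3⟩ := aux_zero s' (a ^ 2 + b ^ 2 * s' - s) (2 * a * b) (by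
    simp only [map_add, map_mul, map_sub, map_pow, map_ofNat]
    linear_combination h2 - (algebraMap (ZMod 4) (AdjoinRoot (X ^ 2 - C s')) b) ^ 2 * h3)
  clear h1 h2 h3 hab hcd e c
  revert s s' a b d
  decide
end

section
/- Let R = ℤ/8ℤ and C = R[τ]/(τ² − 2). There exists an R-algebra automorphism of C sending the generator τ (the class of x) to τ + 4·1, and this automorphism is not the identity. -/
open Polynomial

/-- Over `R = ℤ/8ℤ` and `C = R[τ]/(τ² − 2)`, there is an `R`-algebra
automorphism of `C` sending `τ` to `τ + 4·1`, and it is not the identity. -/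
theorem zmod8_nontrivial_oriented_automorphism :
    ∃ ψ : AdjoinRoot (X ^ 2 - C (2 : ZMod 8)) ≃ₐ[ZMod 8]
        AdjoinRoot (X ^ 2 - C (2 : ZMod 8)),
      ψ (AdjoinRoot.root _) =
        AdjoinRoot.root _ + algebraMap (ZMod 8) _ 4 ∧
      ψ ≠ AlgEquiv.refl := by
  set f : (ZMod 8)[X] := X ^ 2 - C (2 : ZMod 8) with hf
  have hev : ∀ y : AdjoinRoot f, aeval y f = y ^ 2 - algebraMap (ZMod 8) (AdjoinRoot f) 2 := by
    intro y
    have h : aeval y (X ^ 2 - C (2 : ZMod 8)) =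
        y ^ 2 - algebraMap (ZMod 8) (AdjoinRoot f) 2 := by
      rw [map_sub, map_pow, aeval_X, aeval_C]
    exact h
  have hroot : (AdjoinRoot.root f) ^ 2 = algebraMap (ZMod 8) (AdjoinRoot f) 2 := by
    have h : aeval (AdjoinRoot.root f) f = AdjoinRoot.mk f f := AdjoinRoot.aeval_eq f
    rw [AdjoinRoot.mk_self, hev, sub_eq_zero] at h
    exact h
  have h8 : (8 : AdjoinRoot f) = 0 := by
    have h : algebraMap (ZMod 8) (AdjoinRoot f) 8 = 0 := by
      rw [show (8 : ZMod 8) = 0 from by decide, map_zero]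
    rwa [map_ofNat] at h
  have hx : aeval (AdjoinRoot.root f + algebraMap (ZMod 8) (AdjoinRoot f) 4) f = 0 := by
    rw [hev, ← hroot, map_ofNat]
    linear_combination (AdjoinRoot.root f + 2) * h8
  let φ : AdjoinRoot f →ₐ[ZMod 8] AdjoinRoot f :=
    AdjoinRoot.liftAlgHom f (Algebra.ofId _ _) _ hx
  have hφ : φ (AdjoinRoot.root f) =
      AdjoinRoot.root f + algebraMap (ZMod 8) (AdjoinRoot f) 4 :=
    AdjoinRoot.liftAlgHom_root ..
  have hφφ : φ.comp φ = AlgHom.id _ _ := by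
    apply AdjoinRoot.algHom_ext
    rw [AlgHom.comp_apply, hφ, map_add, hφ, AlgHom.commutes, AlgHom.id_apply, map_ofNat]
    linear_combination h8
  refine ⟨AlgEquiv.ofAlgHom φ φ hφφ hφφ, hφ, fun h => ?_⟩
  have h1 : φ (AdjoinRoot.root f) = AdjoinRoot.root f :=
    congrArg (fun e : AdjoinRoot f ≃ₐ[ZMod 8] AdjoinRoot f => e (AdjoinRoot.root f)) h
  rw [hφ, add_eq_left] at h1
  have h2 : AdjoinRoot.mk f (C 4) = 0 := h1
  rw [AdjoinRoot.mk_eq_zero] at h2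
  have : Nontrivial (ZMod 8) := ⟨0, 1, by decide⟩
  have h4 : (4 : ZMod 8) ≠ 0 := by decide
  refine (monic_X_pow_sub_C (2 : ZMod 8) two_ne_zero).not_dvd_of_degree_lt
    (C_ne_zero.2 h4) ?_ h2
  rw [degree_C h4, degree_X_pow_sub_C (by norm_num)]
  norm_num
end

section
/- Let R = ℤ/8ℤ and C = R[τ]/(τ² − 2). Then the group of R-algebra automorphisms of C has exactly 8 elements; they are precisely the maps determined by τ ↦ u·τ + v·1 with u a unit of R and v ∈ {0, 4}. -/
open Polynomial

abbrev QA : Type := AdjoinRoot (X ^ 2 - C (2 : ZMod 8))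

instance qa_nontrivial : Nontrivial (ZMod 8) := ⟨⟨0, 1, by decide⟩⟩

lemma qa_monic_s17 : (X ^ 2 - C (2 : ZMod 8)).Monic := monic_X_pow_sub_C _ (by norm_num)

lemma qa_degree : (X ^ 2 - C (2 : ZMod 8)).degree = 2 := degree_X_pow_sub_C (by norm_num) _

lemma qa_sq : (AdjoinRoot.root (X ^ 2 - C (2 : ZMod 8))) ^ 2 = algebraMap (ZMod 8) QA 2 := by
  have h := AdjoinRoot.eval₂_root (X ^ 2 - C (2 : ZMod 8))
  rw [eval₂_sub, eval₂_X_pow, eval₂_C, sub_eq_zero] at h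
  exact h

lemma qa_exists (x : QA) : ∃ a b : ZMod 8,
    x = algebraMap (ZMod 8) QA a * AdjoinRoot.root _ + algebraMap (ZMod 8) QA b := by
  obtain ⟨p, rfl⟩ := AdjoinRoot.mk_surjective x
  have h2 : (p %ₘ (X ^ 2 - C (2 : ZMod 8))).degree ≤ 1 := by
    have := degree_modByMonic_lt p qa_monic_s17
    rw [qa_degree] at this
    exact Order.lt_succ_iff.mp this
  have h3 := eq_X_add_C_of_degree_le_one h2
  refine ⟨(p %ₘ (X ^ 2 - C (2 : ZMod 8))).coeff 1, (p %ₘ (X ^ 2 - C (2 : ZMod 8))).coeff 0, ?_⟩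
  have h4 : AdjoinRoot.mk (X ^ 2 - C (2 : ZMod 8)) p
      = AdjoinRoot.mk _ (p %ₘ (X ^ 2 - C (2 : ZMod 8))) := by
    rw [AdjoinRoot.mk_eq_mk]
    exact ⟨p /ₘ (X ^ 2 - C (2 : ZMod 8)), by
      linear_combination -(modByMonic_add_div p (X ^ 2 - C (2 : ZMod 8)))⟩
  rw [h4]
  conv_lhs => rw [h3]
  rw [map_add, map_mul, AdjoinRoot.mk_X]
  rfl

lemma qa_zero {a b : ZMod 8}
    (h : algebraMap (ZMod 8) QA a * AdjoinRoot.root _ + algebraMap (ZMod 8) QA b = 0) :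
    a = 0 ∧ b = 0 := by
  have h1 : AdjoinRoot.mk (X ^ 2 - C (2 : ZMod 8)) (C a * X + C b) = 0 := by
    rw [map_add, map_mul, AdjoinRoot.mk_X]
    exact h
  rw [AdjoinRoot.mk_eq_zero] at h1
  have h2 : C a * X + C b = 0 := by
    by_contra hne
    refine qa_monic_s17.not_dvd_of_degree_lt hne ?_ h1
    rw [qa_degree]
    exact lt_of_le_of_lt degree_linear_le (by norm_num)
  constructor
  · simpa using congrArg (fun p => coeff p 1) h2
  · simpa using congrArg (fun p => coeff p 0) h2

lemma qa_inj {a b c d : ZMod 8}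
    (h : algebraMap (ZMod 8) QA a * AdjoinRoot.root _ + algebraMap (ZMod 8) QA b =
      algebraMap (ZMod 8) QA c * AdjoinRoot.root _ + algebraMap (ZMod 8) QA d) :
    a = c ∧ b = d := by
  have := qa_zero (a := a - c) (b := b - d) (by
    rw [map_sub, map_sub]; linear_combination h)
  exact ⟨sub_eq_zero.mp this.1, sub_eq_zero.mp this.2⟩

lemma qa_hom (u v : ZMod 8) (h1 : 2 * u ^ 2 + v ^ 2 = 2) (h2 : 2 * u * v = 0) :
    ∃ f : QA →ₐ[ZMod 8] QA, f (AdjoinRoot.root _) =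
      algebraMap (ZMod 8) QA u * AdjoinRoot.root _ + algebraMap (ZMod 8) QA v := by
  refine ⟨AdjoinRoot.liftAlgHom _ (Algebra.ofId _ _)
    (algebraMap (ZMod 8) QA u * AdjoinRoot.root _ + algebraMap (ZMod 8) QA v) ?_, ?_⟩
  · have e1 := congrArg (algebraMap (ZMod 8) QA) h1
    have e2 := congrArg (algebraMap (ZMod 8) QA) h2
    have e3 := qa_sq
    rw [eval₂_sub, eval₂_X_pow, eval₂_C]
    change _ - algebraMap (ZMod 8) QA 2 = 0
    simp only [map_add, map_mul, map_pow, map_zero] at e1 e2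
    have t2 : algebraMap (ZMod 8) QA 2 = 2 := map_ofNat _ 2
    rw [t2] at e1 e2 e3 ⊢
    linear_combination e1 + AdjoinRoot.root _ * e2 + (algebraMap (ZMod 8) QA u) ^ 2 * e3
  · exact AdjoinRoot.liftAlgHom_root ..

lemma qa_equiv (u : (ZMod 8)ˣ) (v : ZMod 8) (hv : v = 0 ∨ v = 4) :
    ∃ ψ : QA ≃ₐ[ZMod 8] QA, ψ (AdjoinRoot.root _) =
      algebraMap (ZMod 8) QA u * AdjoinRoot.root _ + algebraMap (ZMod 8) QA v := by
  have key : ∀ a b v : ZMod 8, a * b = 1 → (v = 0 ∨ v = 4) →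
      (2 * a ^ 2 + v ^ 2 = 2 ∧ 2 * a * v = 0) ∧
      (2 * b ^ 2 + (- (b * v)) ^ 2 = 2 ∧ 2 * b * (- (b * v)) = 0) := by decide
  have hu : (u : ZMod 8) * (↑u⁻¹ : ZMod 8) = 1 := u.mul_inv
  obtain ⟨⟨k1, k2⟩, k3, k4⟩ := key u (↑u⁻¹ : ZMod 8) v hu hv
  obtain ⟨f, hf⟩ := qa_hom _ _ k1 k2
  obtain ⟨g, hg⟩ := qa_hom _ _ k3 k4
  have e := congrArg (algebraMap (ZMod 8) QA) hu
  rw [map_mul, map_one] at e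
  refine ⟨AlgEquiv.ofAlgHom f g ?_ ?_, hf⟩
  · apply AdjoinRoot.algHom_ext
    simp only [AlgHom.comp_apply, hg, map_add, map_mul, map_neg, AlgHom.commutes, hf,
      AlgHom.id_apply]
    linear_combination AdjoinRoot.root _ * e
  · apply AdjoinRoot.algHom_ext
    simp only [AlgHom.comp_apply, hg, map_add, map_mul, map_neg, AlgHom.commutes, hf,
      AlgHom.id_apply]
    linear_combination (AdjoinRoot.root _ - algebraMap (ZMod 8) QA v) * e

lemma qa_form (ψ : QA ≃ₐ[ZMod 8] QA) :
    ∃ u : (ZMod 8)ˣ, ∃ v : ZMod 8, (v = 0 ∨ v = 4) ∧ ψ (AdjoinRoot.root _) =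
      algebraMap (ZMod 8) QA u * AdjoinRoot.root _ + algebraMap (ZMod 8) QA v := by
  obtain ⟨a, b, h⟩ := qa_exists (ψ (AdjoinRoot.root _))
  obtain ⟨c, d, h'⟩ := qa_exists (ψ.symm (AdjoinRoot.root _))
  have h1 := congrArg ψ h'
  rw [AlgEquiv.apply_symm_apply, map_add, map_mul, AlgEquiv.commutes, AlgEquiv.commutes, h] at h1
  have h2 := qa_inj (a := c * a) (b := c * b + d) (c := 1) (d := 0) (by
    simp only [map_add, map_mul, map_one, map_zero]
    linear_combination -h1)
  have h3 := congrArg ψ qa_sq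
  rw [map_pow, AlgEquiv.commutes, h] at h3
  have h4 := qa_inj (a := 2 * a * b) (b := 2 * a ^ 2 + b ^ 2) (c := 0) (d := 2) (by
    simp only [map_add, map_mul, map_pow, map_zero]
    have t2 : algebraMap (ZMod 8) QA 2 = 2 := map_ofNat _ 2
    have e3 := qa_sq
    rw [t2] at h3 e3 ⊢
    linear_combination h3 - (algebraMap (ZMod 8) QA a) ^ 2 * e3)
  have key : ∀ a b c : ZMod 8, c * a = 1 → 2 * a * b = 0 → 2 * a ^ 2 + b ^ 2 = 2 →
      (b = 0 ∨ b = 4) := by decide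
  exact ⟨⟨a, c, by rw [mul_comm]; exact h2.1, h2.1⟩, b, key a b c h2.1 h4.1 h4.2, h⟩

lemma qa_card : Nat.card (QA ≃ₐ[ZMod 8] QA) = 8 := by
  choose F hF using fun p : (ZMod 8)ˣ × {v : ZMod 8 // v = 0 ∨ v = 4} =>
    qa_equiv p.1 p.2.1 p.2.2
  have hb : Function.Bijective F := by
    constructor
    · intro p q hpq
      have h := hF p
      rw [hpq, hF q] at h
      obtain ⟨h1, h2⟩ := qa_inj h
      exact Prod.ext (Units.ext h1.symm) (Subtype.ext h2.symm)
    · intro ψ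
      obtain ⟨u, v, hv, h⟩ := qa_form ψ
      refine ⟨(u, ⟨v, hv⟩), ?_⟩
      apply AlgEquiv.coe_toAlgHom_injective
      apply AdjoinRoot.algHom_ext
      exact (hF (u, ⟨v, hv⟩)).trans h.symm
  rw [← Nat.card_congr (Equiv.ofBijective F hb), Nat.card_prod, Nat.card_eq_fintype_card,
    ZMod.card_units_eq_totient, Nat.card_eq_fintype_card]
  decide

/-- Over `R = ℤ/8ℤ` and `C = R[τ]/(τ² − 2)`, the group of `R`-algebra
automorphisms of `C` has exactly 8 elements, and they are precisely the maps determined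
by `τ ↦ u·τ + v·1` with `u` a unit of `R` and `v ∈ {0, 4}`. -/
theorem zmod8_automorphism_group :
    Nat.card (AdjoinRoot (X ^ 2 - C (2 : ZMod 8)) ≃ₐ[ZMod 8]
        AdjoinRoot (X ^ 2 - C (2 : ZMod 8))) = 8 ∧
    (∀ ψ : AdjoinRoot (X ^ 2 - C (2 : ZMod 8)) ≃ₐ[ZMod 8]
        AdjoinRoot (X ^ 2 - C (2 : ZMod 8)),
      ∃ u : (ZMod 8)ˣ, ∃ v : ZMod 8, (v = 0 ∨ v = 4) ∧
        ψ (AdjoinRoot.root _) =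
          algebraMap (ZMod 8) _ (u : ZMod 8) * AdjoinRoot.root _ +
            algebraMap (ZMod 8) _ v) ∧
    (∀ u : (ZMod 8)ˣ, ∀ v : ZMod 8, (v = 0 ∨ v = 4) →
      ∃ ψ : AdjoinRoot (X ^ 2 - C (2 : ZMod 8)) ≃ₐ[ZMod 8]
          AdjoinRoot (X ^ 2 - C (2 : ZMod 8)),
        ψ (AdjoinRoot.root _) =
          algebraMap (ZMod 8) _ (u : ZMod 8) * AdjoinRoot.root _ +
            algebraMap (ZMod 8) _ v) := by
  exact ⟨qa_card, qa_form, qa_equiv⟩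
end
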